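/- arXiv:2107.12643 — 5 statements merged into one kernel-verified Lean document; each statement's English description precedes it below -/
import Mathlib

section
/- Let R be a commutative NP-ring (i.e., the nilradical Nil(R) is a prime ideal), let m be a maximal w-ideal of R, and let I be an ideal of R. Then I is a nonnil ideal of R if and only if the extension I_m of I in the localization R_m is a nonnil ideal of R_m. -/
open TensorProduct

universe u v w

section Defs
variable (R : Type*) [CommRing R]

/-- The natural map `R → Hom_R(J, R)` sending `r` to multiplication by `r`. -/
def gvHom (J : Ideal R) : R →ₗ[R] (J →ₗ[R] R) where
  toFun r := r • (Submodule.subtype J)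
  map_add' a b := add_smul a b _
  map_smul' a b := by simp [smul_eq_mul, mul_smul]

/-- `J` is a GV-ideal: finitely generated and `R → Hom_R(J,R)` is an isomorphism. -/
def IsGV (J : Ideal R) : Prop := J.FG ∧ Function.Bijective (gvHom R J)

/-- A module is GV-torsion if every element is annihilated by some GV-ideal. -/
def IsGVTorsion (M : Type v) [AddCommGroup M] [Module R M] : Prop :=
  ∀ x : M, ∃ J : Ideal R, IsGV R J ∧ ∀ j ∈ J, j • x = 0

/-- An ideal is nonnil if it contains a non-nilpotent element. -/
def IsNonnil (I : Ideal R) : Prop := ∃ a ∈ I, ¬IsNilpotent a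

/-- A module is φ-torsion if every element is annihilated by some nonnil ideal. -/
def IsPhiTorsion (M : Type v) [AddCommGroup M] [Module R M] : Prop :=
  ∀ x : M, ∃ I : Ideal R, IsNonnil R I ∧ ∀ r ∈ I, r • x = 0

/-- `M` is φ-flat if for every injective map `f : A → B` with φ-torsion cokernel,
`f ⊗ id_M` is injective. -/
def IsPhiFlat (M : Type v) [AddCommGroup M] [Module R M] : Prop :=
  ∀ (A B : Type u) [AddCommGroup A] [Module R A] [AddCommGroup B] [Module R B]
    (f : A →ₗ[R] B), Function.Injective f → IsPhiTorsion R (B ⧸ LinearMap.range f) →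
      Function.Injective (LinearMap.rTensor M f)

/-- `M` is φ-w-flat if for every injective map `f : A → B` with φ-torsion cokernel,
the kernel of `f ⊗ id_M` is GV-torsion. -/
def IsPhiWFlat (M : Type v) [AddCommGroup M] [Module R M] : Prop :=
  ∀ (A B : Type u) [AddCommGroup A] [Module R A] [AddCommGroup B] [Module R B]
    (f : A →ₗ[R] B), Function.Injective f → IsPhiTorsion R (B ⧸ LinearMap.range f) →
      IsGVTorsion R (LinearMap.ker (LinearMap.rTensor M f))

/-- `M` is w-flat if for every map `f : A → B` with GV-torsion kernel,
the kernel of `f ⊗ id_M` is GV-torsion. -/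
def IsWFlat (M : Type v) [AddCommGroup M] [Module R M] : Prop :=
  ∀ (A B : Type u) [AddCommGroup A] [Module R A] [AddCommGroup B] [Module R B]
    (f : A →ₗ[R] B), IsGVTorsion R (LinearMap.ker f) →
      IsGVTorsion R (LinearMap.ker (LinearMap.rTensor M f))

/-- An ideal is a w-ideal if it equals its w-envelope. -/
def IsWIdeal (I : Ideal R) : Prop :=
  ∀ x : R, (∃ J : Ideal R, IsGV R J ∧ ∀ j ∈ J, j * x ∈ I) → x ∈ I

/-- A maximal w-ideal: maximal among proper w-ideals. -/
def IsMaxWIdeal (m : Ideal R) : Prop :=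
  m ≠ ⊤ ∧ IsWIdeal R m ∧ ∀ I : Ideal R, I ≠ ⊤ → IsWIdeal R I → m ≤ I → I = m

/-- R is a φ-ring: the nilradical is a divided prime. -/
def IsPhiRing : Prop :=
  (nilradical R).IsPrime ∧ ∀ x : R, x ∉ nilradical R → nilradical R ≤ Ideal.span {x}

end Defs

/-- For an NP-ring `R`, a maximal w-ideal `m` (such ideals are prime) and an
ideal `I`, `I` is nonnil iff its extension to the localization `R_m` is nonnil. -/
theorem nonnil_iff_localization_nonnil {R : Type u} [CommRing R]
    (hNP : (nilradical R).IsPrime) (m : Ideal R) (hmax : IsMaxWIdeal R m)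
    [m.IsPrime] (I : Ideal R) :
    IsNonnil R I ↔
      IsNonnil (Localization.AtPrime m)
        (I.map (algebraMap R (Localization.AtPrime m))) := by
  constructor
  · rintro ⟨a, ha, hn⟩
    refine ⟨algebraMap R _ a, Ideal.mem_map_of_mem _ ha, ?_⟩
    rintro ⟨n, h⟩
    rw [← map_pow, IsLocalization.map_eq_zero_iff m.primeCompl] at h
    obtain ⟨s, hs⟩ := h
    have h0 : (s : R) * a ^ n ∈ nilradical R := by rw [hs]; exact zero_mem _
    rcases hNP.mem_or_mem h0 with h1 | h1
    · exact s.2 (nilradical_le_prime m h1)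
    · exact hn (mem_nilradical.mp (hNP.mem_of_pow_mem n h1))
  · rintro ⟨b, hb, hn⟩
    by_contra hI
    have hle : I.map (algebraMap R (Localization.AtPrime m)) ≤
        nilradical (Localization.AtPrime m) := by
      rw [Ideal.map_le_iff_le_comap]
      intro a ha
      by_contra h
      refine hI ⟨a, ha, fun hna => h ?_⟩
      exact mem_nilradical.mpr (hna.map (algebraMap R (Localization.AtPrime m)))
    exact hn (mem_nilradical.mp (hle hb))
end

section
/- Let R be a commutative NP-ring, let m be a maximal w-ideal of R, and let M be an R-module. Then M is a φ-torsion R-module if and only if the localization M_m is a φ-torsion R_m-module. -/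
open TensorProduct

universe u v w

/-- For an NP-ring `R`, a maximal w-ideal `m` (such ideals are prime) and an
`R`-module `M`, `M` is φ-torsion over `R` iff `M_m` is φ-torsion over `R_m`. -/
theorem isPhiTorsion_iff_localization {R : Type u} [CommRing R]
    (hNP : (nilradical R).IsPrime) (m : Ideal R) (hmax : IsMaxWIdeal R m)
    [m.IsPrime] (M : Type v) [AddCommGroup M] [Module R M] :
    IsPhiTorsion R M ↔
      IsPhiTorsion (Localization.AtPrime m) (LocalizedModule m.primeCompl M) := by
  have key : ∀ (a t : R), ¬ IsNilpotent a → t ∈ m.primeCompl → ¬ IsNilpotent (t * a) := by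
    intro a t ha ht h
    rcases hNP.mem_or_mem (mem_nilradical.2 h) with h | h
    · exact ht (nilradical_le_prime m h)
    · exact ha (mem_nilradical.1 h)
  constructor
  · intro h x
    induction x using LocalizedModule.induction_on with
    | _ x s =>
    obtain ⟨I, ⟨a, haI, ha⟩, hI⟩ := h x
    refine ⟨Ideal.span {algebraMap R _ a}, ⟨_, Ideal.mem_span_singleton_self _, ?_⟩, ?_⟩
    · rintro ⟨n, hn⟩
      rw [← map_pow, IsLocalization.map_eq_zero_iff m.primeCompl] at hn
      obtain ⟨t, ht⟩ := hn
      refine key (a ^ n) t (fun hp => ha ?_) t.2 (by rw [ht]; exact IsNilpotent.zero)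
      obtain ⟨k, hk⟩ := hp
      exact ⟨n * k, by rw [pow_mul, hk]⟩
    · intro r hr
      obtain ⟨c, rfl⟩ := Ideal.mem_span_singleton'.1 hr
      rw [mul_smul, algebraMap_smul, LocalizedModule.smul'_mk, hI a haI,
        LocalizedModule.zero_mk, smul_zero]
  · intro h x
    obtain ⟨I, ⟨b, hbI, hb⟩, hI⟩ := h (LocalizedModule.mk x 1)
    obtain ⟨a, s, rfl⟩ := IsLocalization.exists_mk'_eq m.primeCompl b
    have h1 := hI _ (I.mul_mem_left (algebraMap R _ (s : R)) hbI)
    rw [IsLocalization.mk'_spec', algebraMap_smul, LocalizedModule.smul'_mk,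
      ← LocalizedModule.zero_mk 1, LocalizedModule.mk_eq] at h1
    obtain ⟨t, ht⟩ := h1
    have ha : ¬ IsNilpotent a := by
      rintro ⟨n, hn⟩
      refine hb ⟨n, ?_⟩
      rw [← IsLocalization.mk'_pow, hn, IsLocalization.mk'_zero]
    refine ⟨Ideal.span {(t : R) * a}, ⟨_, Ideal.mem_span_singleton_self _, key a t ha t.2⟩, ?_⟩
    intro r hr
    obtain ⟨c, rfl⟩ := Ideal.mem_span_singleton'.1 hr
    rw [mul_smul, mul_smul]
    have ht' : (t : R) • a • x = 0 := by simpa [Submonoid.smul_def] using ht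
    rw [ht', smul_zero]
end

section
/- Let R be a φ-ring and I a nonnil ideal of R. Then Nil(R) = I·Nil(R). -/
open TensorProduct

universe u v w

/-- For a φ-ring `R` and a nonnil ideal `I`, `Nil(R) = I·Nil(R)`. -/
theorem nilradical_eq_mul_nilradical {R : Type u} [CommRing R]
    (hphi : IsPhiRing R) (I : Ideal R) (hI : IsNonnil R I) :
    nilradical R = I * nilradical R := by
  obtain ⟨a, haI, ha⟩ := hI
  refine le_antisymm ?_ Ideal.mul_le_right
  intro x hx
  have ha' : a ∉ nilradical R := fun h => ha (mem_nilradical.mp h)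
  obtain ⟨y, rfl⟩ := Ideal.mem_span_singleton'.mp (hphi.2 a ha' hx)
  have hy : y ∈ nilradical R := (hphi.1.mem_or_mem hx).resolve_right ha'
  rw [mul_comm y a]
  exact Ideal.mul_mem_mul haI hy
end

section
/- Let R be a commutative NP-ring and n a nonnegative integer. Then Tor_{n+1}^R(M, N) is GV-torsion for every R-module M and every φ-torsion R-module N if and only if Tor_{n+1}^R(M, R/I) is GV-torsion for every R-module M and every nonnil ideal I of R. -/
open TensorProduct

universe u v w

section Helpers

variable {R : Type u} [CommRing R]

theorem isGV_inj {J : Ideal R} (h : IsGV R J) {r : R} (hr : ∀ j ∈ J, r * j = 0) : r = 0 := by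
  apply h.2.1
  ext ⟨j, hj⟩
  simpa [gvHom] using hr j hj

theorem isGV_top : IsGV R (⊤ : Ideal R) := by
  refine ⟨⟨{1}, by simp⟩, ?_, ?_⟩
  · intro a b hab
    have := LinearMap.congr_fun hab ⟨1, trivial⟩
    simpa [gvHom] using this
  · intro f
    refine ⟨f ⟨1, trivial⟩, ?_⟩
    ext ⟨j, hj⟩
    have h : (⟨j, hj⟩ : (⊤ : Ideal R)) = j • ⟨1, trivial⟩ := by ext; simp
    rw [h, map_smul, map_smul]
    simp [gvHom, mul_comm]

theorem isGV_mul {I J : Ideal R} (hI : IsGV R I) (hJ : IsGV R J) : IsGV R (I * J) := by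
  refine ⟨hI.1.mul hJ.1, ?_, ?_⟩
  · intro a b hab
    have key : ∀ i ∈ I, ∀ j ∈ J, a * (i * j) = b * (i * j) := by
      intro i hi j hj
      have := LinearMap.congr_fun hab ⟨i * j, Ideal.mul_mem_mul hi hj⟩
      simpa [gvHom] using this
    rw [← sub_eq_zero]
    refine isGV_inj hI fun i hi => isGV_inj hJ fun j hj => ?_
    linear_combination key i hi j hj
  · intro f
    let m : ∀ i : I, (J →ₗ[R] R) := fun i =>
      { toFun := fun j => f ⟨i.1 * j.1, Ideal.mul_mem_mul i.2 j.2⟩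
        map_add' := fun x y => by
          rw [← map_add]; congr 1; ext; simp [mul_add]
        map_smul' := fun c x => by
          rw [← map_smul]; congr 1; ext; simp; ring }
    have hm : ∀ i : I, ∃ c : R, ∀ j : J, c * j.1 = m i j := by
      intro i
      obtain ⟨c, hc⟩ := hJ.2.2 (m i)
      refine ⟨c, fun j => ?_⟩
      rw [← hc]; simp [gvHom]
    choose c hc using hm
    let g : I →ₗ[R] R :=
      { toFun := c
        map_add' := fun x y => by
          rw [← sub_eq_zero]
          refine isGV_inj hJ fun j hj => ?_
          have h1 := hc (x + y) ⟨j, hj⟩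
          have h2 := hc x ⟨j, hj⟩
          have h3 := hc y ⟨j, hj⟩
          have h4 : m (x + y) ⟨j, hj⟩ = m x ⟨j, hj⟩ + m y ⟨j, hj⟩ := by
            change f _ = f _ + f _
            rw [← map_add]; congr 1; ext; simp [add_mul]
          simp only at h1 h2 h3
          linear_combination h1 - h2 - h3 + h4
        map_smul' := fun r x => by
          rw [← sub_eq_zero]
          refine isGV_inj hJ fun j hj => ?_
          have h1 := hc (r • x) ⟨j, hj⟩
          have h2 := hc x ⟨j, hj⟩
          have h4 : m (r • x) ⟨j, hj⟩ = r * m x ⟨j, hj⟩ := by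
            change f _ = r * f _
            refine Eq.trans ?_ (map_smul f r _); congr 1; ext; simp [mul_assoc]
          simp only [smul_eq_mul, RingHom.id_apply] at h1 h2 ⊢
          linear_combination h1 - r * h2 + h4 }
    obtain ⟨r, hr⟩ := hI.2.2 g
    refine ⟨r, ?_⟩
    have key : ∀ (x : R) (hx : x ∈ I * J), r * x = f ⟨x, hx⟩ := by
      intro x hx
      refine Submodule.mul_induction_on' (C := fun x hx => r * x = f ⟨x, hx⟩) ?_ ?_ hx
      · intro i hi j hj
        have h1 := hc ⟨i, hi⟩ ⟨j, hj⟩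
        have h2 : r * i = c ⟨i, hi⟩ := by
          exact LinearMap.congr_fun hr ⟨i, hi⟩
        change c ⟨i, hi⟩ * j = f ⟨i * j, _⟩ at h1
        rw [← h1, ← h2, mul_assoc]
      · intro x hx y hy h1 h2
        rw [mul_add, h1, h2, ← map_add]; rfl
    ext ⟨x, hx⟩
    rw [← key x hx]
    simp [gvHom]

/-- A finite set of elements each killed by a GV-ideal is killed by a common one. -/
theorem gv_finset {M : Type*} [AddCommGroup M] [Module R M] (J : Ideal R) (x : M)
    (h : ∀ j ∈ J, ∃ L : Ideal R, IsGV R L ∧ ∀ l ∈ L, l • (j • x) = 0) (T : Finset R) :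
    (∀ t ∈ T, t ∈ J) →
      ∃ L : Ideal R, IsGV R L ∧ ∀ l ∈ L, ∀ t ∈ T, l • (t • x) = 0 := by
  classical
  induction T using Finset.induction_on with
  | empty => exact fun _ => ⟨⊤, isGV_top, by simp⟩
  | insert a T ha ih =>
    intro hT
    obtain ⟨L, hL, hL'⟩ := ih fun t ht => hT t (Finset.mem_insert_of_mem ht)
    obtain ⟨L2, hL2, hL2'⟩ := h a (hT a (Finset.mem_insert_self _ _))
    refine ⟨L * L2, isGV_mul hL hL2, fun l hl t ht => ?_⟩
    have h12 : l ∈ L ⊓ L2 := Ideal.mul_le_inf hl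
    have h1 : l ∈ L := h12.1
    have h2 : l ∈ L2 := h12.2
    rcases Finset.mem_insert.1 ht with ht | ht
    · rw [ht]; exact hL2' l h2
    · exact hL' l h1 t ht

/-- If `J` is GV and every `j • x` is killed by a GV-ideal, so is `x`. -/
theorem gv_ext {M : Type*} [AddCommGroup M] [Module R M] {J : Ideal R} (hJ : IsGV R J) (x : M)
    (h : ∀ j ∈ J, ∃ L : Ideal R, IsGV R L ∧ ∀ l ∈ L, l • (j • x) = 0) :
    ∃ L : Ideal R, IsGV R L ∧ ∀ l ∈ L, l • x = 0 := by
  obtain ⟨S, hS⟩ := hJ.1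
  obtain ⟨L, hL, hL'⟩ := gv_finset J x h S fun t ht => hS ▸ Ideal.subset_span ht
  refine ⟨L * J, isGV_mul hL hJ, fun l hl => ?_⟩
  refine Submodule.mul_induction_on hl ?_ ?_
  · intro a ha b hb
    rw [← hS] at hb
    rw [mul_smul]
    refine Submodule.span_induction (p := fun b _ => a • b • x = 0) ?_ ?_ ?_ ?_ hb
    · exact fun t ht => hL' a ha t ht
    · simp
    · intro b c _ _ h1 h2
      rw [add_smul, smul_add, h1, h2, add_zero]
    · intro r b _ h1
      rw [smul_assoc, smul_comm, h1, smul_zero]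
  · intro a b h1 h2
    rw [add_smul, h1, h2, add_zero]

/-- The elements of the kernel of `f ⊗ N` are killed by GV-ideals. -/
def KerGV {K G : Type u} [AddCommGroup K] [Module R K] [AddCommGroup G] [Module R G]
    (f : K →ₗ[R] G) (N : Type u) [AddCommGroup N] [Module R N] : Prop :=
  ∀ x : K ⊗[R] N, f.rTensor N x = 0 → ∃ J : Ideal R, IsGV R J ∧ ∀ j ∈ J, j • x = 0

section
variable {K G : Type u} [AddCommGroup K] [Module R K] [AddCommGroup G] [Module R G]
    [Module.Flat R G] (f : K →ₗ[R] G)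

theorem kerGV_ext {A B C : Type u} [AddCommGroup A] [Module R A] [AddCommGroup B] [Module R B]
    [AddCommGroup C] [Module R C] (i : A →ₗ[R] B) (p : B →ₗ[R] C) (hi : Function.Injective i)
    (hp : Function.Surjective p) (hip : Function.Exact i p) (hA : KerGV f A) (hC : KerGV f C) :
    KerGV f B := by
  intro x hx
  have h1 : f.rTensor C (p.lTensor K x) = 0 := by
    rw [← LinearMap.comp_apply, LinearMap.rTensor_comp_lTensor, ← LinearMap.lTensor_comp_rTensor,
      LinearMap.comp_apply, hx, map_zero]
  obtain ⟨J, hJ, hJx⟩ := hC _ h1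
  refine gv_ext hJ x fun j hj => ?_
  have h2 : p.lTensor K (j • x) = 0 := by rw [map_smul, hJx j hj]
  obtain ⟨y, hy⟩ := (lTensor_exact K hip hp _).1 h2
  have h3 : f.rTensor A y = 0 := by
    apply Module.Flat.lTensor_preserves_injective_linearMap (M := G) i hi
    rw [map_zero, ← LinearMap.comp_apply, LinearMap.lTensor_comp_rTensor,
      ← LinearMap.rTensor_comp_lTensor, LinearMap.comp_apply, hy, map_smul, hx, smul_zero]
  obtain ⟨L, hL, hLy⟩ := hA y h3
  exact ⟨L, hL, fun l hl => by rw [← hy, ← map_smul, hLy l hl, map_zero]⟩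

theorem kerGV_fin (h : ∀ I : Ideal R, IsNonnil R I → KerGV f (R ⧸ I)) (n : ℕ) :
    ∀ (N : Type u) [AddCommGroup N] [Module R N], IsPhiTorsion R N → ∀ s : Fin n → N,
      Submodule.span R (Set.range s) = ⊤ → KerGV f N := by
  induction n with
  | zero =>
    intro N _ _ _ s hs x _
    have : Subsingleton N := by
      rw [Set.range_eq_empty, Submodule.span_empty] at hs
      exact (Submodule.subsingleton_iff R).1 (subsingleton_of_bot_eq_top hs)
    exact ⟨⊤, isGV_top, fun j _ => Subsingleton.elim _ _⟩
  | succ n ih =>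
    intro N _ _ hN s hs
    let t := LinearMap.toSpanSingleton R N (s 0)
    refine kerGV_ext f ((LinearMap.ker t).liftQ t le_rfl) (LinearMap.range t).mkQ ?_
      (Submodule.mkQ_surjective _) ?_ (h _ ?_) (ih _ ?_ (fun k => Submodule.Quotient.mk (s k.succ)) ?_)
    · rw [← LinearMap.ker_eq_bot, Submodule.ker_liftQ_eq_bot _ _ _ le_rfl]
    · rw [LinearMap.exact_iff, Submodule.ker_mkQ, Submodule.range_liftQ]
    · obtain ⟨I, ⟨a, ha, hn⟩, hI⟩ := hN (s 0)
      exact ⟨a, by simpa [t] using hI a ha, hn⟩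
    · intro y
      obtain ⟨z, rfl⟩ := Submodule.mkQ_surjective _ y
      obtain ⟨I, hI, hz⟩ := hN z
      exact ⟨I, hI, fun r hr => by rw [← map_smul, hz r hr, map_zero]⟩
    · rw [eq_top_iff, ← Submodule.range_mkQ, LinearMap.range_eq_map (f := (LinearMap.range t).mkQ), ← hs, Submodule.map_span,
        Submodule.span_le]
      rintro _ ⟨_, ⟨k, rfl⟩, rfl⟩
      refine Fin.cases ?_ (fun k => ?_) k
      · have : (LinearMap.range t).mkQ (s 0) = 0 := by
          rw [← LinearMap.mem_ker, Submodule.ker_mkQ]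
          exact ⟨1, by simp [t]⟩
        rw [this]; exact zero_mem _
      · exact Submodule.subset_span ⟨k, rfl⟩

theorem kerGV_all (h : ∀ I : Ideal R, IsNonnil R I → KerGV f (R ⧸ I))
    (N : Type u) [AddCommGroup N] [Module R N] (hN : IsPhiTorsion R N) : KerGV f N := by
  intro x hx
  obtain ⟨N', hfg, hN'⟩ := TensorProduct.exists_finite_submodule_right_of_setFinite {x}
    (Set.finite_singleton x)
  obtain ⟨y, hy⟩ := hN' rfl
  have h3 : f.rTensor N' y = 0 := by
    apply Module.Flat.lTensor_preserves_injective_linearMap (M := G) N'.subtype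
      N'.injective_subtype
    rw [map_zero, ← LinearMap.comp_apply, LinearMap.lTensor_comp_rTensor,
      ← LinearMap.rTensor_comp_lTensor, LinearMap.comp_apply, hy, hx]
  obtain ⟨n, s, hs⟩ := Module.Finite.exists_fin (R := R) (M := N')
  have hT : IsPhiTorsion R N' := by
    intro z
    obtain ⟨I, hI, hz⟩ := hN z.1
    exact ⟨I, hI, fun r hr => Subtype.ext (hz r hr)⟩
  obtain ⟨L, hL, hLy⟩ := kerGV_fin f h n N' hT s hs y h3
  exact ⟨L, hL, fun l hl => by rw [← hy, ← map_smul, hLy l hl, map_zero]⟩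

end

open CategoryTheory MonoidalCategory Limits

theorem tor_flat_isZero (G N : ModuleCat.{u} R) [Module.Flat R G] (P : ProjectiveResolution N)
    (n : ℕ) : IsZero ((((((tensoringLeft (ModuleCat.{u} R)).obj G)).mapHomologicalComplex
      (ComplexShape.down ℕ)).obj P.complex).homology (n+1)) := by
  rw [← HomologicalComplex.exactAt_iff_isZero_homology]
  have h : (P.complex.sc (n + 1)).Exact := P.complex_exactAt_succ n
  have h2 := Module.Flat.lTensor_shortComplex_exact G _ h
  rw [HomologicalComplex.exactAt_iff]
  exact h2

/-- The short complex of complexes. -/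
noncomputable def torSC (S : ShortComplex (ModuleCat.{u} R)) {N : ModuleCat.{u} R}
    (P : ProjectiveResolution N) :
    ShortComplex (ChainComplex (ModuleCat.{u} R) ℕ) where
  X₁ := (((tensoringLeft (ModuleCat.{u} R)).obj S.X₁).mapHomologicalComplex _).obj P.complex
  X₂ := (((tensoringLeft (ModuleCat.{u} R)).obj S.X₂).mapHomologicalComplex _).obj P.complex
  X₃ := (((tensoringLeft (ModuleCat.{u} R)).obj S.X₃).mapHomologicalComplex _).obj P.complex
  f := (NatTrans.mapHomologicalComplex ((tensoringLeft (ModuleCat.{u} R)).map S.f) _).app P.complex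
  g := (NatTrans.mapHomologicalComplex ((tensoringLeft (ModuleCat.{u} R)).map S.g) _).app P.complex
  zero := by
    ext i : 1
    exact (S.map (tensorRight (P.complex.X i))).zero

theorem torSC_shortExact (S : ShortComplex (ModuleCat.{u} R)) (hS : S.ShortExact)
    {N : ModuleCat.{u} R} (P : ProjectiveResolution N) : (torSC S P).ShortExact := by
  refine HomologicalComplex.shortExact_of_degreewise_shortExact _ fun i => ?_
  have : Module.Projective R (P.complex.X i) :=
    (IsProjective.iff_projective _).2 (P.projective i)
  have h := hS.map_of_exact (tensorRight (P.complex.X i))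
  exact h


theorem gvTorsion_of_injective {A B : Type*} [AddCommGroup A] [Module R A] [AddCommGroup B]
    [Module R B] (f : A →ₗ[R] B) (hf : Function.Injective f) (h : IsGVTorsion R B) :
    IsGVTorsion R A := by
  intro x
  obtain ⟨J, hJ, hx⟩ := h (f x)
  exact ⟨J, hJ, fun j hj => hf (by rw [map_smul, hx j hj, map_zero])⟩

theorem gvTorsion_iso {A B : ModuleCat.{u} R} (e : A ≅ B) :
    IsGVTorsion R A ↔ IsGVTorsion R B :=
  ⟨gvTorsion_of_injective e.symm.toLinearEquiv.toLinearMap e.symm.toLinearEquiv.injective,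
    gvTorsion_of_injective e.toLinearEquiv.toLinearMap e.toLinearEquiv.injective⟩

theorem tor_shift (S : ShortComplex (ModuleCat.{u} R)) (hS : S.ShortExact)
    [Module.Flat R S.X₂] (N : ModuleCat.{u} R) (n : ℕ) :
    IsGVTorsion R (((Tor (ModuleCat.{u} R) (n+1+1)).obj S.X₃).obj N) ↔
      IsGVTorsion R (((Tor (ModuleCat.{u} R) (n+1)).obj S.X₁).obj N) := by
  let P := projectiveResolution N
  refine gvTorsion_iso (?_ ≪≫ (torSC_shortExact S hS P).δIso (n+1+1) (n+1) (by simp)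
    (tor_flat_isZero S.X₂ N P (n+1)) (tor_flat_isZero S.X₂ N P n) ≪≫ ?_)
  · exact P.isoLeftDerivedObj ((tensoringLeft (ModuleCat.{u} R)).obj S.X₃) (n+1+1)
  · exact (P.isoLeftDerivedObj ((tensoringLeft (ModuleCat.{u} R)).obj S.X₁) (n+1)).symm

theorem fromLeftDerivedZero_nat {C D : Type*} [Category C] [Abelian C]
    [Category D] [Abelian D] {F G : C ⥤ D} [F.Additive] [G.Additive] (α : F ⟶ G) {X : C}
    (P : ProjectiveResolution X) :
    HomologicalComplex.opcyclesMap ((NatTrans.mapHomologicalComplex α _).app P.complex) 0 ≫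
      P.fromLeftDerivedZero' G = P.fromLeftDerivedZero' F ≫ α.app X := by
  rw [← cancel_epi (HomologicalComplex.pOpcycles _ _), HomologicalComplex.p_opcyclesMap_assoc,
    ProjectiveResolution.pOpcycles_comp_fromLeftDerivedZero',
    ProjectiveResolution.pOpcycles_comp_fromLeftDerivedZero'_assoc]
  exact (α.naturality (P.π.f 0)).symm

/-- The degree zero identification. -/
noncomputable def torZero (M : ModuleCat.{u} R) {N : ModuleCat.{u} R}
    (P : ProjectiveResolution N) :
    ((((tensoringLeft (ModuleCat.{u} R)).obj M).mapHomologicalComplex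
      (ComplexShape.down ℕ)).obj P.complex).homology 0 ⟶ M ⊗ N :=
  (ChainComplex.isoHomologyι₀ _).hom ≫
    P.fromLeftDerivedZero' ((tensoringLeft (ModuleCat.{u} R)).obj M)

instance (M : ModuleCat.{u} R) : PreservesFiniteColimits
    ((tensoringLeft (ModuleCat.{u} R)).obj M) :=
  inferInstanceAs (PreservesFiniteColimits (tensorLeft M))

instance (M : ModuleCat.{u} R) {N : ModuleCat.{u} R}
    (P : ProjectiveResolution N) : IsIso (torZero M P) := by
  unfold torZero
  infer_instance

theorem torZero_nat (S : ShortComplex (ModuleCat.{u} R)) {N : ModuleCat.{u} R}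
    (P : ProjectiveResolution N) :
    HomologicalComplex.homologyMap (torSC S P).f 0 ≫ torZero S.X₂ P =
      torZero S.X₁ P ≫ S.f ▷ N := by
  have h := fromLeftDerivedZero_nat ((tensoringLeft (ModuleCat.{u} R)).map S.f) P
  unfold torZero
  rw [Category.assoc]
  refine Eq.trans ?_ (congrArg (fun z => (ChainComplex.isoHomologyι₀ _).hom ≫ z) h)
  exact HomologicalComplex.homologyι_naturality_assoc (torSC S P).f 0 _

theorem ker_abstract {A B C B' C' : Type*} [AddCommGroup A] [Module R A] [AddCommGroup B]
    [Module R B] [AddCommGroup C] [Module R C] [AddCommGroup B'] [Module R B']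
    [AddCommGroup C'] [Module R C'] (d : A →ₗ[R] B) (g : B →ₗ[R] C) (e₁ : B →ₗ[R] B')
    (e₂ : C →ₗ[R] C') (g' : B' →ₗ[R] C') (hd : Function.Injective d) (hex : Function.Exact d g)
    (h1 : Function.Bijective e₁) (h2 : Function.Bijective e₂) (hn : ∀ y, e₂ (g y) = g' (e₁ y)) :
    IsGVTorsion R A ↔
      ∀ x : B', g' x = 0 → ∃ J : Ideal R, IsGV R J ∧ ∀ j ∈ J, j • x = 0 := by
  constructor
  · intro h x hx
    obtain ⟨y, rfl⟩ := h1.2 x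
    rw [← hn] at hx
    have hy : g y = 0 := h2.1 (hx.trans (map_zero e₂).symm)
    obtain ⟨z, rfl⟩ := (hex y).1 hy
    obtain ⟨J, hJ, hz⟩ := h z
    refine ⟨J, hJ, fun j hj => ?_⟩
    rw [← map_smul, ← map_smul, hz j hj, map_zero, map_zero]
  · intro h z
    have hz : g' (e₁ (d z)) = 0 := by
      rw [← hn, hex.apply_apply_eq_zero, map_zero]
    obtain ⟨J, hJ, hx⟩ := h _ hz
    refine ⟨J, hJ, fun j hj => hd (h1.1 ?_)⟩
    rw [map_smul, map_smul, hx j hj, map_zero, map_zero]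

theorem tor_one (S : ShortComplex (ModuleCat.{u} R)) (hS : S.ShortExact)
    [Module.Flat R S.X₂] (N : ModuleCat.{u} R) :
    IsGVTorsion R (((Tor (ModuleCat.{u} R) (0+1)).obj S.X₃).obj N) ↔ KerGV S.f.hom N := by
  let P := projectiveResolution N
  have hT := torSC_shortExact S hS P
  have e : ((Tor (ModuleCat.{u} R) (0+1)).obj S.X₃).obj N ≅ (torSC S P).X₃.homology 1 :=
    P.isoLeftDerivedObj ((tensoringLeft (ModuleCat.{u} R)).obj S.X₃) 1
  rw [gvTorsion_iso e]
  have hm : Mono (hT.δ 1 0 (by simp)) := hT.mono_δ 1 0 (by simp) (tor_flat_isZero S.X₂ N P 0)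
  have hex := (ShortComplex.ShortExact.moduleCat_exact_iff_function_exact _).1 (hT.homology_exact₁ 1 0 (by simp))
  have hδ := (ModuleCat.mono_iff_injective _).1 hm
  have h1 : Function.Bijective (torZero S.X₁ P) := ConcreteCategory.bijective_of_isIso _
  have h2 : Function.Bijective (torZero S.X₂ P) := ConcreteCategory.bijective_of_isIso _
  have hnat : ∀ y : (torSC S P).X₁.homology 0,
      torZero S.X₂ P (HomologicalComplex.homologyMap (torSC S P).f 0 y) =
        S.f.hom.rTensor N (torZero S.X₁ P y) := fun y =>
    ConcreteCategory.congr_hom (torZero_nat S P) y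
  exact ker_abstract (hT.δ 1 0 (by simp)).hom (HomologicalComplex.homologyMap (torSC S P).f 0).hom
    (torZero S.X₁ P).hom (torZero S.X₂ P).hom (S.f.hom.rTensor N) hδ hex h1 h2 hnat

/-- Every `Tor` in positive degree is governed by a kernel of `f ⊗ N` with flat target. -/
theorem tor_ker (n : ℕ) : ∀ M : ModuleCat.{u} R, ∃ S : ShortComplex (ModuleCat.{u} R),
    Module.Flat R S.X₂ ∧ ∀ N : ModuleCat.{u} R,
      (IsGVTorsion R (((Tor (ModuleCat.{u} R) (n+1)).obj M).obj N) ↔ KerGV S.f.hom N) := by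
  have res : ∀ M : ModuleCat.{u} R, ∃ S : ShortComplex (ModuleCat.{u} R),
      S.X₃ = M ∧ S.ShortExact ∧ Module.Flat R S.X₂ := by
    intro M
    let p : (M →₀ R) →ₗ[R] M := Finsupp.linearCombination R id
    have hp : Function.Surjective p := Finsupp.linearCombination_id_surjective R M
    refine ⟨ShortComplex.mk (X₁ := ModuleCat.of R (LinearMap.ker p))
        (X₂ := ModuleCat.of R (M →₀ R)) (X₃ := M)
        (ModuleCat.ofHom (LinearMap.ker p).subtype) (ModuleCat.ofHom p) ?_,
      rfl, ?_, ?_⟩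
    · ext x; exact x.2
    · refine @ShortComplex.ShortExact.mk _ _ _ _ ?_ ?_ ?_
      · rw [ShortComplex.ShortExact.moduleCat_exact_iff_function_exact]
        exact LinearMap.exact_subtype_ker_map p
      · exact (ModuleCat.mono_iff_injective _).2 (Submodule.injective_subtype _)
      · exact (ModuleCat.epi_iff_surjective _).2 hp
    · exact inferInstanceAs (Module.Flat R (M →₀ R))
  induction n with
  | zero =>
    intro M
    obtain ⟨S, rfl, hS, hf⟩ := res M
    exact ⟨S, hf, fun N => tor_one S hS N⟩
  | succ n ih =>
    intro M
    obtain ⟨S, rfl, hS, hf⟩ := res M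
    obtain ⟨S', hf', h⟩ := ih S.X₁
    exact ⟨S', hf', fun N => (tor_shift S hS N n).trans (h N)⟩

end Helpers

open CategoryTheory in
/-- For an NP-ring `R` and `n ≥ 0`, `Tor_{n+1}^R(M, N)` is GV-torsion for
every `R`-module `M` and every φ-torsion module `N` iff `Tor_{n+1}^R(M, R/I)` is
GV-torsion for every `R`-module `M` and every nonnil ideal `I`. -/
theorem tor_gvTorsion_iff_tor_quotient {R : Type u} [CommRing R]
    (hNP : (nilradical R).IsPrime) (n : ℕ) :
    (∀ (M N : Type u) [AddCommGroup M] [Module R M] [AddCommGroup N] [Module R N],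
        IsPhiTorsion R N →
        IsGVTorsion R
          (((Tor (ModuleCat.{u} R) (n+1)).obj (ModuleCat.of R M)).obj (ModuleCat.of R N))) ↔
      (∀ (M : Type u) [AddCommGroup M] [Module R M] (I : Ideal R), IsNonnil R I →
        IsGVTorsion R
          (((Tor (ModuleCat.{u} R) (n+1)).obj (ModuleCat.of R M)).obj
            (ModuleCat.of R (R ⧸ I)))) := by
  constructor
  · intro h M _ _ I hI
    refine h M (R ⧸ I) fun x => ⟨I, hI, fun r hr => ?_⟩
    obtain ⟨y, rfl⟩ := Submodule.mkQ_surjective I x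
    rw [← map_smul, ← LinearMap.mem_ker, Submodule.ker_mkQ]
    exact I.mul_mem_right y hr
  · intro h M N _ _ _ _ hN
    obtain ⟨S, hf, hS⟩ := tor_ker n (ModuleCat.of R M)
    exact (hS (ModuleCat.of R N)).2 (kerGV_all S.f.hom
      (fun I hI => (hS (ModuleCat.of R (R ⧸ I))).1 (h M I hI)) N hN)
end

section
/- Let R be a strongly φ-ring. Then R/Nil(R) is a Prüfer v-multiplication domain (PvMD) if and only if R is a PvMR, i.e., for every finitely generated ideal I of R containing a non-zero-divisor, (I·I^{-1})_w = R, where I^{-1} = {x ∈ T(R) : xI ⊆ R}, T(R) is the total quotient ring of R, and for an R-submodule A of T(R), A_w = {x ∈ T(R) : Jx ⊆ A for some GV-ideal J of R}. -/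
open TensorProduct

universe u v w

section PvM
variable (D : Type u) [CommRing D]

/-- `I⁻¹ = {x ∈ T(D) : xI ⊆ D}` inside the total quotient ring `T(D)`
(the quotient field when `D` is a domain). -/
def idealInvSet (I : Ideal D) : Set (FractionRing D) :=
  {z | ∀ b ∈ I, ∃ d : D,
    z * algebraMap D (FractionRing D) b = algebraMap D (FractionRing D) d}

/-- The `D`-submodule `I·I⁻¹` of the total quotient ring. -/
def idealInvProd (I : Ideal D) : Submodule D (FractionRing D) :=
  Submodule.span D
    {y | ∃ a ∈ I, ∃ z ∈ idealInvSet D I, y = algebraMap D (FractionRing D) a * z}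

/-- `I` is `w`-invertible: `(I·I⁻¹)_w = D`. -/
def IsWInvertible (I : Ideal D) : Prop :=
  {x : FractionRing D | ∃ J : Ideal D, IsGV D J ∧ ∀ j ∈ J, j • x ∈ idealInvProd D I}
    = Set.range (algebraMap D (FractionRing D))

/-- A Prüfer `v`-multiplication domain: an integral domain in which every nonzero
finitely generated ideal is `w`-invertible. -/
def IsPvMD : Prop :=
  IsDomain D ∧ ∀ I : Ideal D, I.FG → I ≠ ⊥ → IsWInvertible D I

/-- A Prüfer `v`-multiplication ring: every finitely generated ideal containing a
non-zero-divisor is `w`-invertible. -/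
def IsPvMR : Prop :=
  ∀ I : Ideal D, I.FG → (∃ a ∈ I, a ∈ nonZeroDivisors D) → IsWInvertible D I

end PvM

/-- A φ-chain ring: a φ-ring in which any two non-nilpotent elements divide one another. -/
def IsPhiChainRing (S : Type*) [CommRing S] : Prop :=
  IsPhiRing S ∧ ∀ a b : S, a ∉ nilradical S → b ∉ nilradical S → a ∣ b ∨ b ∣ a

/-- A strongly φ-ring: a φ-ring in which every zero-divisor is nilpotent. -/
def IsStronglyPhiRing (S : Type*) [CommRing S] : Prop :=
  IsPhiRing S ∧ ∀ r : S, (∃ s : S, s ≠ 0 ∧ r * s = 0) → IsNilpotent r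

section Helpers

theorem aux_gv_iff {D : Type*} [CommRing D] {J : Ideal D} {s : D} (hsJ : s ∈ J)
    (hs : s ∈ nonZeroDivisors D) :
    IsGV D J ↔ J.FG ∧ ∀ b, (∀ j ∈ J, s ∣ b * j) → s ∣ b := by
  have canc : ∀ x y : D, s * x = s * y → x = y := fun x y h =>
    (mul_cancel_left_mem_nonZeroDivisors hs).1 h
  unfold IsGV
  refine and_congr_right fun _ => ⟨fun h b hb => ?_, fun h => ⟨?_, ?_⟩⟩
  · choose d hd using hb
    let f : J →ₗ[D] D :=
      { toFun := fun j => d j.1 j.2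
        map_add' := by
          intro x y
          apply canc
          rw [mul_add, ← hd, ← hd, ← hd]
          simp [mul_add]
        map_smul' := by
          intro r x
          apply canc
          have := hd x.1 x.2
          have h2 := hd (r • x).1 (r • x).2
          simp only [Submodule.coe_smul, smul_eq_mul, RingHom.id_apply] at *
          linear_combination r * this - h2 }
    obtain ⟨r, hr⟩ := h.2 f
    have h1 := LinearMap.congr_fun hr ⟨s, hsJ⟩
    have h2 : r * s = d s hsJ := by simpa [gvHom, f] using h1
    refine ⟨r, canc _ _ ?_⟩
    have := hd s hsJ
    linear_combination this - s * h2
  · intro r r' hr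
    have h1 := LinearMap.congr_fun hr ⟨s, hsJ⟩
    have h2 : r * s = r' * s := by simpa [gvHom] using h1
    apply canc
    linear_combination h2
  · intro f
    have key : ∀ j : J, s * f j = f ⟨s, hsJ⟩ * j.1 := by
      intro j
      have e : s • j = j.1 • (⟨s, hsJ⟩ : J) := by
        ext
        simp [mul_comm]
      have := congrArg f e
      simp only [map_smul, smul_eq_mul] at this
      rw [this, mul_comm]
    obtain ⟨r, hr⟩ := h (f ⟨s, hsJ⟩) (fun j hj => ⟨f ⟨j, hj⟩, (key ⟨j, hj⟩).symm⟩)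
    refine ⟨r, LinearMap.ext fun j => canc _ _ ?_⟩
    have := key j
    have e : gvHom D J r j = r * j.1 := by simp [gvHom]
    rw [e, this, hr]
    ring

/-- The ideal `(a : I)`. -/
def auxColon {D : Type*} [CommRing D] (a : D) (I : Ideal D) : Ideal D where
  carrier := {b | ∀ i ∈ I, a ∣ b * i}
  add_mem' := by
    intro x y hx hy i hi
    rw [add_mul]
    exact dvd_add (hx i hi) (hy i hi)
  zero_mem' := by
    intro i _
    simp
  smul_mem' := by
    intro c x hx i hi
    rw [smul_eq_mul, mul_assoc]
    exact (hx i hi).mul_left c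

theorem aux_mem_colon {D : Type*} [CommRing D] {a : D} {I : Ideal D} {b : D} :
    b ∈ auxColon a I ↔ ∀ i ∈ I, a ∣ b * i := Iff.rfl

theorem aux_mem_prod {D : Type u} [CommRing D] {I : Ideal D} {a : D} (haI : a ∈ I)
    (ha : a ∈ nonZeroDivisors D) (y : FractionRing D) :
    y ∈ idealInvProd D I ↔ ∃ c ∈ I * auxColon a I,
      algebraMap D (FractionRing D) a * y = algebraMap D (FractionRing D) c := by
  have hinj : Function.Injective (algebraMap D (FractionRing D)) :=
    IsFractionRing.injective D _
  have hu : IsUnit (algebraMap D (FractionRing D) a) :=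
    IsLocalization.map_units (FractionRing D) (⟨a, ha⟩ : nonZeroDivisors D)
  constructor
  · intro h
    unfold idealInvProd at h
    induction h using Submodule.span_induction with
    | mem x hx =>
      obtain ⟨i, hi, z, hz, rfl⟩ := hx
      obtain ⟨d, hd⟩ := hz a haI
      refine ⟨i * d, Ideal.mul_mem_mul hi ?_, ?_⟩
      · intro k hk
        obtain ⟨e, he⟩ := hz k hk
        refine ⟨e, hinj ?_⟩
        rw [map_mul, map_mul, ← hd, ← he]
        ring
      · rw [map_mul, ← hd]
        ring
    | zero => exact ⟨0, zero_mem _, by simp⟩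
    | add x y _ _ hx hy =>
      obtain ⟨c, hc, h1⟩ := hx
      obtain ⟨c', hc', h2⟩ := hy
      exact ⟨c + c', add_mem hc hc', by rw [mul_add, h1, h2, map_add]⟩
    | smul r x _ hx =>
      obtain ⟨c, hc, h1⟩ := hx
      refine ⟨r * c, Ideal.mul_mem_left _ _ hc, ?_⟩
      rw [Algebra.smul_def, map_mul, ← h1]
      ring
  · rintro ⟨c, hc, h⟩
    obtain ⟨v, hv⟩ := hu.exists_left_inv
    have hy : y = v * algebraMap D (FractionRing D) c := by
      rw [← h, ← mul_assoc, hv, one_mul]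
    rw [hy]
    clear h hy
    induction hc using Submodule.mul_induction_on' with
    | mem_mul_mem i hi b hb =>
      refine Submodule.subset_span ⟨i, hi, v * algebraMap D (FractionRing D) b, ?_, ?_⟩
      · intro k hk
        obtain ⟨e, he⟩ := hb k hk
        refine ⟨e, ?_⟩
        rw [mul_assoc, ← map_mul, he, map_mul, ← mul_assoc, hv, one_mul]
      · rw [map_mul]
        ring
    | add x _ y _ hx hy =>
      rw [map_add, mul_add]
      exact add_mem hx hy

theorem aux_winv_iff {D : Type u} [CommRing D]
    (hGV : ∀ J : Ideal D, IsGV D J → ∃ s ∈ J, s ∈ nonZeroDivisors D)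
    {I : Ideal D} {a : D} (haI : a ∈ I) (ha : a ∈ nonZeroDivisors D) :
    IsWInvertible D I ↔ ∃ J : Ideal D, IsGV D J ∧ ∀ j ∈ J, a * j ∈ I * auxColon a I := by
  have hinj : Function.Injective (algebraMap D (FractionRing D)) :=
    IsFractionRing.injective D _
  unfold IsWInvertible
  constructor
  · intro h
    have h1 : (1 : FractionRing D) ∈ Set.range (algebraMap D (FractionRing D)) :=
      ⟨1, map_one _⟩
    rw [← h] at h1
    obtain ⟨J, hJ, hj⟩ := h1
    refine ⟨J, hJ, fun j hjJ => ?_⟩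
    obtain ⟨c, hc, h2⟩ := (aux_mem_prod haI ha _).1 (hj j hjJ)
    rw [Algebra.smul_def, mul_one, ← map_mul] at h2
    rw [hinj h2]
    exact hc
  · rintro ⟨J, hJ, hj⟩
    ext x
    constructor
    · rintro ⟨J', hJ', hx⟩
      have hR : ∀ j ∈ J', ∃ d, algebraMap D (FractionRing D) j * x
          = algebraMap D (FractionRing D) d := by
        intro j hjJ
        obtain ⟨c, hc, h2⟩ := (aux_mem_prod haI ha _).1 (hx j hjJ)
        have hca : c ∈ Ideal.span {a} := by
          refine (Ideal.mul_le.2 ?_) hc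
          intro i hi b hb
          rw [Ideal.mem_span_singleton, mul_comm]
          exact hb i hi
        obtain ⟨d, rfl⟩ := Ideal.mem_span_singleton.1 hca
        refine ⟨d, ?_⟩
        have hu : IsUnit (algebraMap D (FractionRing D) a) :=
          IsLocalization.map_units (FractionRing D) (⟨a, ha⟩ : nonZeroDivisors D)
        rw [map_mul] at h2
        rw [← Algebra.smul_def]
        exact hu.mul_left_cancel h2
      obtain ⟨s, hsJ, hs⟩ := hGV J' hJ'
      obtain ⟨d, hd⟩ := hR s hsJ
      have hu : IsUnit (algebraMap D (FractionRing D) s) :=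
        IsLocalization.map_units (FractionRing D) (⟨s, hs⟩ : nonZeroDivisors D)
      obtain ⟨r, hr⟩ := ((aux_gv_iff hsJ hs).1 hJ').2 d (by
        intro j hjJ
        obtain ⟨e, he⟩ := hR j hjJ
        refine ⟨e, hinj ?_⟩
        rw [map_mul, map_mul, ← hd, ← he]
        ring)
      refine ⟨r, hu.mul_left_cancel ?_⟩
      rw [hd, hr, map_mul]
    · rintro ⟨r, rfl⟩
      refine ⟨J, hJ, fun j hjJ => (aux_mem_prod haI ha _).2
        ⟨r * (a * j), Ideal.mul_mem_left _ _ (hj j hjJ), ?_⟩⟩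
      rw [Algebra.smul_def]
      simp only [map_mul]
      ring

theorem aux_gv_domain {D : Type*} [CommRing D] [IsDomain D] (J : Ideal D) (h : IsGV D J) :
    ∃ s ∈ J, s ∈ nonZeroDivisors D := by
  by_contra hc
  push Not at hc
  have h0 : ∀ j ∈ J, j = 0 := by
    intro j hj
    by_contra hne
    exact hc j hj (mem_nonZeroDivisors_of_ne_zero hne)
  have : (1 : D) = 0 := h.2.1 (LinearMap.ext fun j => by
    simp [gvHom, h0 j.1 j.2])
  exact one_ne_zero this

section Phi
variable {R : Type u} [CommRing R]

theorem aux_nzd_iff (h : IsStronglyPhiRing R) (a : R) :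
    a ∈ nonZeroDivisors R ↔ a ∉ nilradical R := by
  constructor
  · intro ha hn
    obtain ⟨n, hn⟩ := mem_nilradical.1 hn
    have h1 : (0 : R) ∈ nonZeroDivisors R := hn ▸ pow_mem ha n
    haveI := Ideal.Quotient.nontrivial_iff.2 h.1.1.ne_top
    have : Nontrivial R := (Ideal.Quotient.mk (nilradical R)).domain_nontrivial
    exact zero_notMem_nonZeroDivisors h1
  · intro ha
    rw [mem_nonZeroDivisors_iff_right]
    intro x hx
    by_contra hne
    exact ha (mem_nilradical.2 (h.2 a ⟨x, hne, by rw [mul_comm]; exact hx⟩))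

theorem aux_gv_phi (h : IsStronglyPhiRing R) (J : Ideal R) (hJ : IsGV R J) :
    ∃ s ∈ J, s ∈ nonZeroDivisors R := by
  by_contra hc
  push Not at hc
  have hle : J ≤ nilradical R := fun j hj => by
    by_contra hne
    exact hc j hj ((aux_nzd_iff h j).2 hne)
  have hnil : ∃ n, J ^ n = ⊥ := by
    obtain ⟨n, hn⟩ := Ideal.exists_pow_le_of_le_radical_of_fg (I := J) (J := ⊥) hle hJ.1
    exact ⟨n, le_bot_iff.1 hn⟩
  have key : ∀ n, J ^ n = ⊥ → False := by
    intro n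
    induction n with
    | zero =>
      intro h0
      apply h.1.1.ne_top
      rw [pow_zero, Ideal.one_eq_top] at h0
      exact top_le_iff.1 (h0 ▸ bot_le)
    | succ n ih =>
      intro h0
      apply ih
      rw [eq_bot_iff]
      intro x hx
      have : x = 0 := hJ.2.1 (LinearMap.ext fun j => by
        have : x * j.1 ∈ J ^ (n + 1) := by
          rw [pow_succ]
          exact Ideal.mul_mem_mul hx j.2
        rw [h0] at this
        simpa [gvHom] using this)
      simpa using this
  obtain ⟨n, hn⟩ := hnil
  exact key n hn

theorem aux_dvd_iff (h : IsStronglyPhiRing R) {s : R} (hs : s ∉ nilradical R) (b : R) :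
    Ideal.Quotient.mk (nilradical R) s ∣ Ideal.Quotient.mk (nilradical R) b ↔ s ∣ b := by
  refine ⟨?_, fun hd => map_dvd _ hd⟩
  rintro ⟨c, hc⟩
  obtain ⟨c, rfl⟩ := Ideal.Quotient.mk_surjective c
  rw [← map_mul, Ideal.Quotient.eq] at hc
  have := Ideal.mem_span_singleton.1 (h.1.2 s hs hc)
  exact (dvd_sub_left (dvd_mul_right s c)).1 this

theorem aux_comap_map (h : IsStronglyPhiRing R) {I : Ideal R} {s : R} (hsI : s ∈ I)
    (hs : s ∉ nilradical R) (x : R) :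
    Ideal.Quotient.mk (nilradical R) x ∈ I.map (Ideal.Quotient.mk (nilradical R)) ↔ x ∈ I := by
  rw [Ideal.mem_quotient_iff_mem]
  exact (h.1.2 s hs).trans ((Ideal.span_singleton_le_iff_mem _).2 hsI)

theorem aux_fg_iff (h : IsStronglyPhiRing R) {I : Ideal R} {s : R} (hsI : s ∈ I)
    (hs : s ∉ nilradical R) :
    (I.map (Ideal.Quotient.mk (nilradical R))).FG ↔ I.FG := by
  refine ⟨?_, fun hf => hf.map _⟩
  classical
  rintro ⟨S, hS⟩
  let g : R ⧸ nilradical R → R := Function.surjInv Ideal.Quotient.mk_surjective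
  have hg : ∀ x, Ideal.Quotient.mk (nilradical R) (g x) = x :=
    Function.surjInv_eq Ideal.Quotient.mk_surjective
  refine ⟨insert s (S.image g), le_antisymm ?_ ?_⟩
  · refine Ideal.span_le.2 ?_
    intro x hx
    simp only [Finset.coe_insert, Finset.coe_image, Set.mem_insert_iff, Set.mem_image] at hx
    rcases hx with rfl | ⟨y, hy, rfl⟩
    · exact hsI
    · rw [SetLike.mem_coe, ← aux_comap_map h hsI hs, hg, ← hS]
      exact Ideal.subset_span hy
  · intro x hx
    have hs' : s ∈ Ideal.span ((insert s (S.image g) : Finset R) : Set R) :=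
      Ideal.subset_span (by simp)
    refine (aux_comap_map h hs' hs x).1 ?_
    have h1 := Ideal.mem_map_of_mem (Ideal.Quotient.mk (nilradical R)) hx
    rw [← hS] at h1
    refine (Ideal.span_le.2 ?_) h1
    intro y hy
    rw [SetLike.mem_coe, ← hg y]
    exact Ideal.mem_map_of_mem _ (Ideal.subset_span (by
      simp only [Finset.coe_insert, Finset.coe_image]
      exact Or.inr ⟨y, hy, rfl⟩))

theorem aux_nzd_quot (h : IsStronglyPhiRing R) {s : R} (hs : s ∉ nilradical R) :
    Ideal.Quotient.mk (nilradical R) s ∈ nonZeroDivisors (R ⧸ nilradical R) := by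
  haveI := h.1.1
  apply mem_nonZeroDivisors_of_ne_zero
  rwa [Ne, Ideal.Quotient.eq_zero_iff_mem]

theorem aux_gv_quot (h : IsStronglyPhiRing R) {J : Ideal R} {s : R} (hsJ : s ∈ J)
    (hs : s ∉ nilradical R) :
    IsGV (R ⧸ nilradical R) (J.map (Ideal.Quotient.mk (nilradical R))) ↔ IsGV R J := by
  rw [aux_gv_iff hsJ ((aux_nzd_iff h s).2 hs),
    aux_gv_iff (Ideal.mem_map_of_mem _ hsJ) (aux_nzd_quot h hs), aux_fg_iff h hsJ hs]
  refine and_congr_right fun _ => ?_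
  rw [Ideal.Quotient.mk_surjective.forall]
  refine forall_congr' fun b => ?_
  rw [aux_dvd_iff h hs, Ideal.Quotient.mk_surjective.forall]
  simp only [aux_comap_map h hsJ hs, ← map_mul, aux_dvd_iff h hs]

theorem aux_map_colon (h : IsStronglyPhiRing R) {I : Ideal R} {a : R} (haI : a ∈ I)
    (ha : a ∉ nilradical R) :
    auxColon (Ideal.Quotient.mk (nilradical R) a) (I.map (Ideal.Quotient.mk (nilradical R)))
      = (auxColon a I).map (Ideal.Quotient.mk (nilradical R)) := by
  ext x
  obtain ⟨x, rfl⟩ := Ideal.Quotient.mk_surjective x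
  have haC : a ∈ auxColon a I := fun i _ => dvd_mul_right a i
  rw [aux_comap_map h haC ha, aux_mem_colon, aux_mem_colon, Ideal.Quotient.mk_surjective.forall]
  simp only [aux_comap_map h haI ha, ← map_mul, aux_dvd_iff h ha]

theorem aux_winv_quot (h : IsStronglyPhiRing R) {I : Ideal R} {a : R} (haI : a ∈ I)
    (ha : a ∉ nilradical R) :
    IsWInvertible (R ⧸ nilradical R) (I.map (Ideal.Quotient.mk (nilradical R))) ↔
      IsWInvertible R I := by
  haveI := h.1.1
  have haC : a ∈ auxColon a I := fun i _ => dvd_mul_right a i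
  have haa : a * a ∉ nilradical R := fun hm => (h.1.1.mem_or_mem hm).elim ha ha
  rw [aux_winv_iff (aux_gv_phi h) haI ((aux_nzd_iff h a).2 ha),
    aux_winv_iff aux_gv_domain (Ideal.mem_map_of_mem _ haI) (aux_nzd_quot h ha),
    aux_map_colon h haI ha, ← Ideal.map_mul]
  constructor
  · rintro ⟨J, hJ, hj⟩
    obtain ⟨s, hsJ, hs⟩ := aux_gv_domain J hJ
    obtain ⟨s, rfl⟩ := Ideal.Quotient.mk_surjective s
    have hs' : s ∉ nilradical R := by
      rw [← Ideal.Quotient.eq_zero_iff_mem]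
      exact nonZeroDivisors.ne_zero hs
    refine ⟨J.comap (Ideal.Quotient.mk (nilradical R)), ?_, ?_⟩
    · rw [← aux_gv_quot h (s := s) hsJ hs',
        Ideal.map_comap_of_surjective _ Ideal.Quotient.mk_surjective]
      exact hJ
    · intro j hjJ
      have := hj _ hjJ
      rwa [← map_mul, aux_comap_map h (Ideal.mul_mem_mul haI haC) haa] at this
  · rintro ⟨J, hJ, hj⟩
    obtain ⟨s, hsJ, hs⟩ := aux_gv_phi h J hJ
    have hs' := (aux_nzd_iff h s).1 hs
    refine ⟨_, (aux_gv_quot h hsJ hs').2 hJ, ?_⟩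
    rw [Ideal.Quotient.mk_surjective.forall]
    intro j hjJ
    rw [aux_comap_map h hsJ hs'] at hjJ
    rw [← map_mul]
    exact Ideal.mem_map_of_mem _ (hj j hjJ)

end Phi
end Helpers

/-- For a strongly φ-ring `R`, `R/Nil(R)` is a PvMD iff `R` is a PvMR. -/
theorem quotient_pvmd_iff_pvmr {R : Type u} [CommRing R]
    (hsphi : IsStronglyPhiRing R) :
    IsPvMD (R ⧸ nilradical R) ↔ IsPvMR R := by
  constructor
  · rintro ⟨_, hD⟩ I hI ⟨a, haI, ha⟩
    have ha' := (aux_nzd_iff hsphi a).1 ha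
    refine (aux_winv_quot hsphi haI ha').1 (hD _ (hI.map _) ?_)
    intro h0
    have := Ideal.mem_map_of_mem (Ideal.Quotient.mk (nilradical R)) haI
    rw [h0, Ideal.mem_bot, Ideal.Quotient.eq_zero_iff_mem] at this
    exact ha' this
  · intro hR
    haveI := hsphi.1.1
    refine ⟨inferInstance, fun I hI hne => ?_⟩
    obtain ⟨a, haI, ha⟩ := Submodule.exists_mem_ne_zero_of_ne_bot hne
    obtain ⟨a, rfl⟩ := Ideal.Quotient.mk_surjective a
    have ha' : a ∉ nilradical R := by rwa [Ne, Ideal.Quotient.eq_zero_iff_mem] at ha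
    have hm : (I.comap (Ideal.Quotient.mk (nilradical R))).map
        (Ideal.Quotient.mk (nilradical R)) = I :=
      Ideal.map_comap_of_surjective _ Ideal.Quotient.mk_surjective I
    have haI' : a ∈ I.comap (Ideal.Quotient.mk (nilradical R)) := haI
    rw [← hm]
    refine (aux_winv_quot hsphi haI' ha').2 (hR _ ?_ ⟨a, haI', (aux_nzd_iff hsphi a).2 ha'⟩)
    rw [← aux_fg_iff hsphi haI' ha', hm]
    exact hI
end
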